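/- Fix integers d ≥ 1 and r ≥ 1, a differentiable pure-state family ψ at θ₀ on ℂ^d and a POVM M on ℂ^d with r outcomes. Then unitary preprocessing is optimal among all quantum preprocessing channels: F^P(ρ₀, ρ₀', M) = F^U(ρ₀, ρ₀', M). Equivalently, for every ancilla dimension a ≥ 1, γ({Mᵢ ⊗ 1_a}) = γ({Mᵢ}), where {Mᵢ ⊗ 1_a} is the POVM on ℂ^d ⊗ ℂ^a with elements Mᵢ ⊗ 1_a. -/

import Mathlib

open scoped Matrix Kronecker ComplexOrder
open Classical

noncomputable section

/-- A density matrix: positive semidefinite with unit trace. -/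
def IsDensityMatrix {n : Type*} [Fintype n] (ρ : Matrix n n ℂ) : Prop :=
  ρ.PosSemidef ∧ ρ.trace = 1

/-- A POVM with `r` outcomes. -/
def IsPOVM {n : Type*} [Fintype n] [DecidableEq n] {r : ℕ}
    (M : Fin r → Matrix n n ℂ) : Prop :=
  (∀ i, (M i).PosSemidef) ∧ ∑ i, M i = 1

/-- The Fisher information of the measurement-outcome distribution. -/
def FisherInfo {n : Type*} [Fintype n] {r : ℕ}
    (ρ ρ' : Matrix n n ℂ) (M : Fin r → Matrix n n ℂ) : ℝ :=
  ∑ i, if (ρ * M i).trace = 0 then 0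
    else ((ρ' * M i).trace.re) ^ 2 / ((ρ * M i).trace.re)

/-- A quantum channel (CPTP map) given by finitely many Kraus operators. -/
def IsQuantumChannel {m n : Type*} [Fintype m] [Fintype n] [DecidableEq m]
    (E : Matrix m m ℂ → Matrix n n ℂ) : Prop :=
  ∃ (κ : ℕ) (K : Fin κ → Matrix n m ℂ),
    (∑ j, (K j)ᴴ * K j = 1) ∧ ∀ σ, E σ = ∑ j, K j * σ * (K j)ᴴ

/-- Quantum preprocessing-optimized Fisher information. -/
def QPFI {m n : Type*} [Fintype m] [Fintype n] [DecidableEq m] {r : ℕ}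
    (ρ ρ' : Matrix m m ℂ) (M : Fin r → Matrix n n ℂ) : ℝ :=
  sSup {x : ℝ | ∃ E : Matrix m m ℂ → Matrix n n ℂ,
    IsQuantumChannel E ∧ x = FisherInfo (E ρ) (E ρ') M}

/-- Quantum unitary-preprocessing-optimized Fisher information. -/
def QUPFI {n : Type*} [Fintype n] [DecidableEq n] {r : ℕ}
    (ρ ρ' : Matrix n n ℂ) (M : Fin r → Matrix n n ℂ) : ℝ :=
  sSup {x : ℝ | ∃ U : Matrix n n ℂ, U ∈ Matrix.unitaryGroup n ℂ ∧
    x = FisherInfo (U * ρ * Uᴴ) (U * ρ' * Uᴴ) M}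

/-- Complex inner product, conjugate-linear in the first argument. -/
def cInner {n : Type*} [Fintype n] (φ ψ : n → ℂ) : ℂ := ∑ k, star (φ k) * ψ k

/-- The functional whose supremum over orthonormal pairs is the normalized QPFI. -/
def gammaSummand {n : Type*} [Fintype n] {r : ℕ}
    (M : Fin r → Matrix n n ℂ) (φ φp : n → ℂ) : ℝ :=
  ∑ i, if cInner φ (M i *ᵥ φ) = 0 then 0
    else ((cInner φ (M i *ᵥ φp)).re) ^ 2 / ((cInner φ (M i *ᵥ φ)).re)

/-- The normalized QPFI of a POVM. -/
def gammaPOVM {n : Type*} [Fintype n] {r : ℕ} (M : Fin r → Matrix n n ℂ) : ℝ :=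
  sSup {x : ℝ | ∃ φ φp : n → ℂ,
    cInner φ φ = 1 ∧ cInner φp φp = 1 ∧ cInner φ φp = 0 ∧ x = gammaSummand M φ φp}

/-- Quantum Fisher information: the Fisher information optimized over all POVMs. -/
def QFI {m : Type*} [Fintype m] [DecidableEq m] (ρ ρ' : Matrix m m ℂ) : ℝ :=
  sSup {x : ℝ | ∃ (κ : ℕ) (T : Fin κ → Matrix m m ℂ), IsPOVM T ∧ x = FisherInfo ρ ρ' T}

/-- Classical Fisher information of a finite probability distribution. -/
def classFisher {r : ℕ} (p p' : Fin r → ℝ) : ℝ :=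
  ∑ i, if p i = 0 then 0 else (p' i) ^ 2 / p i

lemma cInner_eq {n : Type*} [Fintype n] (x y : n → ℂ) : cInner x y = star x ⬝ᵥ y := rfl

lemma cInner_conj {n : Type*} [Fintype n] (x y : n → ℂ) : star (cInner x y) = cInner y x := by
  simp [cInner, mul_comm]

lemma cInner_herm {n : Type*} [Fintype n] {M : Matrix n n ℂ} (hM : M.IsHermitian) (x y : n → ℂ) :
    star (cInner x (M *ᵥ y)) = cInner y (M *ᵥ x) := by
  rw [cInner_eq, cInner_eq, ← Matrix.star_dotProduct_star, star_star, Matrix.star_mulVec, hM.eq,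
    ← Matrix.dotProduct_mulVec, dotProduct_comm]

lemma cInner_self_im {n : Type*} [Fintype n] {M : Matrix n n ℂ} (hM : M.IsHermitian) (x : n → ℂ) :
    (cInner x (M *ᵥ x)).im = 0 := by
  have := cInner_herm hM x x
  exact Complex.conj_eq_iff_im.1 this

lemma cInner_add_left {n : Type*} [Fintype n] (x y z : n → ℂ) :
    cInner (x + y) z = cInner x z + cInner y z := by
  simp [cInner_eq, add_dotProduct]

lemma cInner_add_right {n : Type*} [Fintype n] (x y z : n → ℂ) :
    cInner x (y + z) = cInner x y + cInner x z := by
  simp [cInner_eq, dotProduct_add]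

lemma cInner_sub_right {n : Type*} [Fintype n] (x y z : n → ℂ) :
    cInner x (y - z) = cInner x y - cInner x z := by
  simp [cInner_eq, dotProduct_sub]

lemma cInner_smul_left {n : Type*} [Fintype n] (c : ℂ) (x y : n → ℂ) :
    cInner (c • x) y = star c * cInner x y := by
  simp [cInner_eq, smul_dotProduct]

lemma cInner_smul_right {n : Type*} [Fintype n] (c : ℂ) (x y : n → ℂ) :
    cInner x (c • y) = c * cInner x y := by
  simp [cInner_eq, dotProduct_smul]

lemma cInner_psd {n : Type*} [Fintype n] {M : Matrix n n ℂ} (hM : M.PosSemidef) (x : n → ℂ) :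
    0 ≤ (cInner x (M *ᵥ x)).re := by
  exact (Complex.le_def.1 (hM.dotProduct_mulVec_nonneg x)).1

lemma cInner_self_ofReal {n : Type*} [Fintype n] (x : n → ℂ) :
    cInner x x = ((cInner x x).re : ℂ) := by
  apply Complex.ext
  · simp
  · have := cInner_conj x x
    simpa using Complex.conj_eq_iff_im.1 this

lemma cInner_self_nonneg {n : Type*} [Fintype n] (x : n → ℂ) : 0 ≤ (cInner x x).re := by
  rw [cInner_eq]
  exact (Complex.le_def.1 (dotProduct_star_self_nonneg (star x))).1.trans (by rw [star_star, dotProduct_comm])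

lemma cInner_self_pos {n : Type*} [Fintype n] {x : n → ℂ} (hx : x ≠ 0) : 0 < (cInner x x).re := by
  refine lt_of_le_of_ne (cInner_self_nonneg x) fun h => hx ?_
  have := cInner_self_ofReal x
  rw [← h] at this
  rw [cInner_eq] at this
  simpa using this

/-- Cauchy–Schwarz -/
lemma cs_psd {n : Type*} [Fintype n] {M : Matrix n n ℂ} (hM : M.PosSemidef) (x y : n → ℂ) :
    (cInner x (M *ᵥ y)).re ^ 2 ≤ (cInner x (M *ᵥ x)).re * (cInner y (M *ᵥ y)).re := by
  have key : ∀ t : ℝ, 0 ≤ (cInner y (M *ᵥ y)).re * (t * t) + (2 * (cInner x (M *ᵥ y)).re) * t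
      + (cInner x (M *ᵥ x)).re := by
    intro t
    have h := cInner_psd hM (x + (t : ℂ) • y)
    have h2 : (cInner y (M *ᵥ x)).re = (cInner x (M *ᵥ y)).re := by
      rw [← cInner_herm hM.1 x y]; simp
    simp only [Matrix.mulVec_add, Matrix.mulVec_smul, cInner_add_left, cInner_add_right,
      cInner_smul_left, cInner_smul_right, Complex.add_re, RCLike.star_def, Complex.conj_ofReal,
      Complex.re_ofReal_mul, h2] at h
    linarith
  have := discrim_le_zero key
  rw [discrim] at this
  nlinarith

lemma gamma_eq {n : Type*} [Fintype n] {r : ℕ} (M : Fin r → Matrix n n ℂ) (x y : n → ℂ) :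
    gammaSummand M x y = ∑ i, (cInner x (M i *ᵥ y)).re ^ 2 / (cInner x (M i *ᵥ x)).re := by
  unfold gammaSummand
  refine Finset.sum_congr rfl fun i _ => ?_
  split_ifs with h
  · simp [h]
  · rfl

lemma sum_cInner {n : Type*} [Fintype n] [DecidableEq n] {r : ℕ} {M : Fin r → Matrix n n ℂ}
    (hM : ∑ i, M i = 1) (x y : n → ℂ) : ∑ i, cInner x (M i *ᵥ y) = cInner x y := by
  simp only [cInner_eq]
  rw [← dotProduct_sum, ← Matrix.sum_mulVec, hM, Matrix.one_mulVec]

lemma gamma_le_norm {n : Type*} [Fintype n] [DecidableEq n] {r : ℕ} {M : Fin r → Matrix n n ℂ}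
    (hM : IsPOVM M) (x y : n → ℂ) : gammaSummand M x y ≤ (cInner y y).re := by
  rw [gamma_eq, ← sum_cInner hM.2 y y, Complex.re_sum]
  refine Finset.sum_le_sum fun i _ => ?_
  exact div_le_of_le_mul₀ (cInner_psd (hM.1 i) x) (cInner_psd (hM.1 i) y)
    ((cs_psd (hM.1 i) x y).trans (mul_comm _ _).le)

lemma gamma_nonneg {n : Type*} [Fintype n] [DecidableEq n] {r : ℕ} {M : Fin r → Matrix n n ℂ}
    (hM : IsPOVM M) (x y : n → ℂ) : 0 ≤ gammaSummand M x y := by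
  rw [gamma_eq]
  exact Finset.sum_nonneg fun i _ => div_nonneg (sq_nonneg _) (cInner_psd (hM.1 i) x)

lemma gammaPOVM_nonneg {n : Type*} [Fintype n] [DecidableEq n] {r : ℕ} {M : Fin r → Matrix n n ℂ}
    (hM : IsPOVM M) : 0 ≤ gammaPOVM M := by
  apply Real.sSup_nonneg
  rintro _ ⟨x, y, -, -, -, rfl⟩
  exact gamma_nonneg hM x y

lemma le_gammaPOVM {n : Type*} [Fintype n] [DecidableEq n] {r : ℕ} {M : Fin r → Matrix n n ℂ}
    (hM : IsPOVM M) {x y : n → ℂ} (h1 : cInner x x = 1) (h2 : cInner y y = 1)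
    (h3 : cInner x y = 0) : gammaSummand M x y ≤ gammaPOVM M := by
  apply le_csSup
  · refine ⟨1, ?_⟩
    rintro _ ⟨x, y, -, h, -, rfl⟩
    simpa [h] using gamma_le_norm hM x y
  · exact ⟨x, y, h1, h2, h3, rfl⟩

lemma gamma_smul {n : Type*} [Fintype n] {r : ℕ} (M : Fin r → Matrix n n ℂ) (x y : n → ℂ)
    {s : ℝ} (hs : s ≠ 0) (t : ℝ) :
    gammaSummand M ((s : ℂ) • x) ((t : ℂ) • y) = t ^ 2 * gammaSummand M x y := by
  rw [gamma_eq, gamma_eq, Finset.mul_sum]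
  refine Finset.sum_congr rfl fun i _ => ?_
  simp only [Matrix.mulVec_smul, cInner_smul_left, cInner_smul_right, RCLike.star_def,
    Complex.conj_ofReal, Complex.re_ofReal_mul]
  by_cases h : (cInner x (M i *ᵥ x)).re = 0
  · simp [h]
  · field_simp

lemma gamma_shift {n : Type*} [Fintype n] [DecidableEq n] {r : ℕ} {M : Fin r → Matrix n n ℂ} (hM : IsPOVM M)
    (x y : n → ℂ) {c : ℂ} (hc : c.re = 0) :
    gammaSummand M x (y - c • x) = gammaSummand M x y := by
  rw [gamma_eq, gamma_eq]
  refine Finset.sum_congr rfl fun i _ => ?_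
  simp [Matrix.mulVec_sub, Matrix.mulVec_smul, cInner_sub_right, cInner_smul_right, hc,
    cInner_self_im (hM.1 i).1 x]

lemma cInner_unit {n : Type*} [Fintype n] {x : n → ℂ} (hx : x ≠ 0) :
    cInner (((√(cInner x x).re)⁻¹ : ℝ) • x) (((√(cInner x x).re)⁻¹ : ℝ) • x) = 1 := by
  have h := cInner_self_pos hx
  have e : ∀ (s : ℝ), s • x = (s : ℂ) • x := fun s => by ext; simp
  rw [e, cInner_smul_left, cInner_smul_right, RCLike.star_def, Complex.conj_ofReal,
    cInner_self_ofReal x]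
  norm_cast
  have := Real.mul_self_sqrt h.le
  have h0 : √(cInner x x).re ≠ 0 := (Real.sqrt_pos.2 h).ne'
  field_simp
  nlinarith

lemma gamma_bound {n : Type*} [Fintype n] [DecidableEq n] {r : ℕ} {M : Fin r → Matrix n n ℂ} (hM : IsPOVM M)
    (x y : n → ℂ) (h : (cInner x y).re = 0) :
    gammaSummand M x y ≤ gammaPOVM M * (cInner y y).re := by
  have hG := gammaPOVM_nonneg hM
  by_cases hx : x = 0
  · rw [gamma_eq]
    simpa [hx, cInner] using mul_nonneg hG (cInner_self_nonneg y)
  have hxp := cInner_self_pos hx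
  have hxr := cInner_self_ofReal x
  set N := (cInner x x).re with hN
  set c := cInner x y / N with hc
  have hcr : c.re = 0 := by simp [hc, h]
  set z := y - c • x with hz
  have hN0 : (N : ℂ) ≠ 0 := by exact_mod_cast hxp.ne'
  have hxz : cInner x z = 0 := by
    rw [hz, cInner_sub_right, cInner_smul_right, hxr, hc]
    field_simp; simp
  have hzy : (cInner z z).re ≤ (cInner y y).re := by
    have hy : y = z + c • x := by simp [hz]
    have hzx : cInner z x = 0 := by rw [← cInner_conj, hxz]; simp
    have : cInner y y = cInner z z + star c * c * N := by
      rw [hy]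
      simp only [cInner_add_left, cInner_add_right, cInner_smul_left, cInner_smul_right, hxz, hzx,
        hxr]
      ring
    rw [this]
    simp only [Complex.add_re, Complex.re_mul_ofReal, RCLike.star_def, ← Complex.normSq_eq_conj_mul_self, Complex.ofReal_re]
    nlinarith [Complex.normSq_nonneg c]
  rw [← gamma_shift hM x y hcr]
  refine le_trans ?_ (mul_le_mul_of_nonneg_left hzy hG)
  by_cases hz0 : z = 0
  · rw [← hz, gamma_eq]
    simp [hz0, cInner]
  have hzp := cInner_self_pos hz0
  set s := (√N)⁻¹
  set t := (√(cInner z z).re)⁻¹ with ht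
  have hs : s ≠ 0 := inv_ne_zero (Real.sqrt_pos.2 hxp).ne'
  have e : ∀ (s : ℝ) (x : n → ℂ), s • x = (s : ℂ) • x := fun s x => by ext; simp
  have := le_gammaPOVM hM (cInner_unit hx) (cInner_unit hz0) (by
    rw [e, e, cInner_smul_left, cInner_smul_right, hxz]; simp)
  rw [e, e, gamma_smul M x z hs, ← ht] at this
  have ht2 : t ^ 2 * (cInner z z).re = 1 := by
    rw [ht, inv_pow, Real.sq_sqrt hzp.le]; field_simp
  calc gammaSummand M x z = (t ^ 2 * gammaSummand M x z) * (cInner z z).re := by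
        rw [mul_right_comm, ht2, one_mul]
    _ ≤ _ := mul_le_mul_of_nonneg_right this hzp.le

lemma gamma_le_csum {J : Type*} [Fintype J] (x p : J → ℝ) (hp : ∀ j, 0 ≤ p j)
    (h0 : ∀ j, p j = 0 → x j = 0) :
    (∑ j, x j) ^ 2 / ∑ j, p j ≤ ∑ j, x j ^ 2 / p j := by
  refine div_le_of_le_mul₀ (Finset.sum_nonneg fun j _ => hp j)
    (Finset.sum_nonneg fun j _ => div_nonneg (sq_nonneg _) (hp j)) ?_
  refine Finset.sum_sq_le_sum_mul_sum_of_sq_le_mul _ (fun j _ => div_nonneg (sq_nonneg _) (hp j))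
    (fun j _ => hp j) fun j _ => ?_
  by_cases h : p j = 0
  · simp [h, h0 j h]
  · exact (div_mul_cancel₀ _ h).ge

lemma exists_isometry {a : ℕ} (H : Matrix (Fin a) (Fin a) ℂ) (hH : H.IsHermitian)
    (htr : H.trace = 0) : ∃ (b : Type) (_ : Fintype b) (V : Matrix b (Fin a) ℂ),
      Vᴴ * V = 1 ∧ ∀ j, (V * H * Vᴴ) j j = 0 := by
  rcases Nat.eq_zero_or_pos a with rfl | ha
  · exact ⟨Fin 0, inferInstance, 0, by ext i; exact i.elim0, fun j => j.elim0⟩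
  have : NeZero a := ⟨ha.ne'⟩
  let F : Matrix (AddChar (Fin a) ℂ) (Fin a) ℂ := Matrix.of fun χ k => χ k / (√a : ℝ)
  have hsq : ((√a : ℝ) : ℂ) * ((√a : ℝ) : ℂ) = a := by
    rw [← Complex.ofReal_mul, Real.mul_self_sqrt (by positivity)]; simp
  have ha0 : (a : ℂ) ≠ 0 := by exact_mod_cast ha.ne'
  have hF : Fᴴ * F = 1 := by
    ext k l
    have h1 : (Fᴴ * F) k l = (∑ χ : AddChar (Fin a) ℂ, χ (l - k)) / a := by
      rw [Matrix.mul_apply, Finset.sum_div]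
      refine Finset.sum_congr rfl fun χ _ => ?_
      simp only [F, Matrix.conjTranspose_apply, Matrix.of_apply, star_div₀, RCLike.star_def,
        Complex.conj_ofReal]
      rw [div_mul_div_comm, hsq, sub_eq_add_neg, AddChar.map_add_eq_mul, AddChar.map_neg_eq_conj,
        mul_comm]
    rw [h1, AddChar.sum_apply_eq_ite, Matrix.one_apply]
    by_cases h : k = l
    · simp [h, ha0]
    · simp [h, sub_eq_zero, Ne.symm h]
  let U : Matrix (Fin a) (Fin a) ℂ := hH.eigenvectorUnitary
  have hU : U * Uᴴ = 1 := Matrix.mem_unitaryGroup_iff.1 hH.eigenvectorUnitary.2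
  have hU' : Uᴴ * U = 1 := Matrix.mem_unitaryGroup_iff'.1 hH.eigenvectorUnitary.2
  let D : Matrix (Fin a) (Fin a) ℂ := Matrix.diagonal (fun i => (hH.eigenvalues i : ℂ))
  have hsp : H = U * D * Uᴴ := by
    have := hH.spectral_theorem
    rw [Unitary.conjStarAlgAut_apply] at this
    exact this
  have hD : ∑ i, (hH.eigenvalues i : ℂ) = 0 := by
    rw [← htr, hH.trace_eq_sum_eigenvalues]; rfl
  refine ⟨AddChar (Fin a) ℂ, inferInstance, F * Uᴴ, ?_, fun j => ?_⟩
  · rw [Matrix.conjTranspose_mul, Matrix.conjTranspose_conjTranspose, Matrix.mul_assoc,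
      ← Matrix.mul_assoc Fᴴ, hF, Matrix.one_mul, hU]
  · have : F * Uᴴ * H * (F * Uᴴ)ᴴ = F * D * Fᴴ := by
      rw [Matrix.conjTranspose_mul, Matrix.conjTranspose_conjTranspose, hsp]
      calc _ = F * (Uᴴ * U) * D * (Uᴴ * U) * Fᴴ := by simp only [Matrix.mul_assoc]
        _ = _ := by rw [hU']; simp
    rw [this, Matrix.mul_apply]
    calc _ = ∑ k, (hH.eigenvalues k : ℂ) / a := by
          refine Finset.sum_congr rfl fun k _ => ?_
          simp only [D, Matrix.mul_diagonal, F, Matrix.conjTranspose_apply, Matrix.of_apply,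
            star_div₀, RCLike.star_def, Complex.conj_ofReal]
          have h1 : j k * (starRingEnd ℂ) (j k) = 1 := by
            rw [Complex.mul_conj, Complex.normSq_eq_norm_sq, AddChar.norm_apply]; simp
          rw [div_mul_eq_mul_div, div_mul_div_comm, hsq, mul_right_comm, h1, one_mul]
      _ = 0 := by rw [← Finset.sum_div, hD, zero_div]

lemma diag_cInner {n J : Type*} [Fintype n] (Φ X : Matrix n J ℂ) (M : Matrix n n ℂ) (k l : J) :
    (Φᴴ * M * X) k l = cInner (fun i => Φ i k) (M *ᵥ (fun i => X i l)) := by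
  rw [Matrix.mul_assoc, Matrix.mul_apply]
  simp [cInner, Matrix.mul_apply, Matrix.mulVec, dotProduct]

lemma trace_cInner {n J : Type*} [Fintype n] [Fintype J] (Φ X : Matrix n J ℂ) (M : Matrix n n ℂ) :
    (Φᴴ * M * X).trace = ∑ j, cInner (fun i => Φ i j) (M *ᵥ (fun i => X i j)) := by
  rw [Matrix.trace]
  exact Finset.sum_congr rfl fun j _ => diag_cInner Φ X M j j

lemma family_bound0 {n J : Type*} [Fintype n] [DecidableEq n] [Fintype J] {r : ℕ} {M : Fin r → Matrix n n ℂ}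
    (hM : IsPOVM M) (Φ X : Matrix n J ℂ) (h : ∀ j, ((Φᴴ * X) j j).re = 0) :
    ∑ i, (Φᴴ * M i * X).trace.re ^ 2 / (Φᴴ * M i * Φ).trace.re
      ≤ gammaPOVM M * (Xᴴ * X).trace.re := by
  have hone : ∀ (A B : Matrix n J ℂ) k l, (Aᴴ * B) k l
      = cInner (fun i => A i k) (fun i => B i l) := fun A B k l => by
    simp [Matrix.mul_apply, cInner]
  calc _ ≤ ∑ i, ∑ j, (cInner (fun i => Φ i j) (M i *ᵥ (fun i => X i j))).re ^ 2 /
        (cInner (fun i => Φ i j) (M i *ᵥ (fun i => Φ i j))).re := by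
        refine Finset.sum_le_sum fun i _ => ?_
        rw [trace_cInner, trace_cInner, Complex.re_sum, Complex.re_sum]
        refine gamma_le_csum _ _ (fun j => cInner_psd (hM.1 i) _) fun j hj => ?_
        have := cs_psd (hM.1 i) (fun i => Φ i j) (fun i => X i j)
        rw [hj, zero_mul] at this
        exact pow_eq_zero_iff two_ne_zero |>.1 (le_antisymm this (sq_nonneg _))
    _ = ∑ j, gammaSummand M (fun i => Φ i j) (fun i => X i j) := by
        rw [Finset.sum_comm]; simp only [gamma_eq]
    _ ≤ ∑ j, gammaPOVM M * (cInner (fun i => X i j) (fun i => X i j)).re := by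
        refine Finset.sum_le_sum fun j _ => gamma_bound hM _ _ ?_
        rw [← hone, h j]
    _ = _ := by
        rw [← Finset.mul_sum, Matrix.trace, Complex.re_sum]
        simp only [Matrix.diag_apply, hone]

lemma family_bound {n : Type*} [Fintype n] [DecidableEq n] {a r : ℕ} {M : Fin r → Matrix n n ℂ}
    (hM : IsPOVM M) (Φ X : Matrix n (Fin a) ℂ) (h : (Φᴴ * X).trace.re = 0) :
    ∑ i, (Φᴴ * M i * X).trace.re ^ 2 / (Φᴴ * M i * Φ).trace.re
      ≤ gammaPOVM M * (Xᴴ * X).trace.re := by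
  obtain ⟨b, _, V, hV, hd⟩ := exists_isometry (Φᴴ * X + (Φᴴ * X)ᴴ)
    (by rw [Matrix.IsHermitian, Matrix.conjTranspose_add, Matrix.conjTranspose_conjTranspose,
      add_comm])
    (by
      rw [Matrix.trace_add, Matrix.trace_conjTranspose]
      apply Complex.ext <;> simp [h])
  have htr : ∀ A : Matrix (Fin a) (Fin a) ℂ, (V * A * Vᴴ).trace = A.trace := fun A => by
    rw [Matrix.trace_mul_comm, ← Matrix.mul_assoc, hV, Matrix.one_mul]
  have key := family_bound0 hM (Φ * Vᴴ) (X * Vᴴ) (fun j => by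
    have := hd j
    rw [Matrix.mul_add, Matrix.add_mul, Matrix.add_apply] at this
    have e1 : (Φ * Vᴴ)ᴴ * (X * Vᴴ) = V * (Φᴴ * X) * Vᴴ := by
      simp [Matrix.conjTranspose_mul, Matrix.mul_assoc]
    have e2 : V * (Φᴴ * X)ᴴ * Vᴴ = (V * (Φᴴ * X) * Vᴴ)ᴴ := by
      simp [Matrix.conjTranspose_mul, Matrix.mul_assoc]
    rw [e2, Matrix.conjTranspose_apply, ← e1] at this
    have h3 := congrArg Complex.re this
    simp only [Complex.add_re, RCLike.star_def, Complex.conj_re, Complex.zero_re] at h3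
    linarith)
  have e : ∀ (A B : Matrix n (Fin a) ℂ) (N : Matrix n n ℂ),
      ((A * Vᴴ)ᴴ * N * (B * Vᴴ)).trace = (Aᴴ * N * B).trace := fun A B N => by
    rw [← htr (Aᴴ * N * B)]
    simp [Matrix.conjTranspose_mul, Matrix.mul_assoc]
  have e' : ((X * Vᴴ)ᴴ * (X * Vᴴ)).trace = (Xᴴ * X).trace := by
    rw [← htr (Xᴴ * X)]
    simp [Matrix.conjTranspose_mul, Matrix.mul_assoc]
  simpa only [e, e'] using key

lemma fisher_eq {n : Type*} [Fintype n] {r : ℕ} (ρ ρ' : Matrix n n ℂ) (M : Fin r → Matrix n n ℂ) :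
    FisherInfo ρ ρ' M = ∑ i, (ρ' * M i).trace.re ^ 2 / (ρ * M i).trace.re := by
  unfold FisherInfo
  refine Finset.sum_congr rfl fun i _ => ?_
  split_ifs with h
  · simp [h]
  · rfl

/-- Fisher information of a purified family. -/
lemma fisher_family {n J : Type*} [Fintype n] [Fintype J] [DecidableEq n] {r : ℕ}
    {M : Fin r → Matrix n n ℂ} (hM : IsPOVM M) (Φ X : Matrix n J ℂ) :
    FisherInfo (Φ * Φᴴ) (X * Φᴴ + Φ * Xᴴ) M
      = 4 * ∑ i, (Φᴴ * M i * X).trace.re ^ 2 / (Φᴴ * M i * Φ).trace.re := by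
  rw [fisher_eq, Finset.mul_sum]
  refine Finset.sum_congr rfl fun i _ => ?_
  have h0 : ∀ A B : Matrix n J ℂ, (A * Bᴴ * M i).trace = (Bᴴ * M i * A).trace := fun A B => by
    rw [Matrix.mul_assoc, Matrix.trace_mul_comm]
  have h1 : (Xᴴ * M i * Φ).trace = star (Φᴴ * M i * X).trace := by
    rw [← Matrix.trace_conjTranspose]
    simp only [Matrix.conjTranspose_mul, Matrix.conjTranspose_conjTranspose, (hM.1 i).1.eq,
      Matrix.mul_assoc]
  rw [Matrix.add_mul, Matrix.trace_add, h0, h0, h0, h1]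
  simp only [Complex.add_re, RCLike.star_def, Complex.conj_re]
  ring

lemma fisher_pure {n : Type*} [Fintype n] [DecidableEq n] {r : ℕ}
    {M : Fin r → Matrix n n ℂ} (hM : IsPOVM M) (x y : n → ℂ) :
    FisherInfo (Matrix.vecMulVec x (star x))
      (Matrix.vecMulVec y (star x) + Matrix.vecMulVec x (star y)) M = 4 * gammaSummand M x y := by
  have e : ∀ u v : n → ℂ, Matrix.vecMulVec u (star v)
      = Matrix.replicateCol Unit u * (Matrix.replicateCol Unit v)ᴴ := fun u v => by
    ext i j
    simp [Matrix.vecMulVec, Matrix.mul_apply]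
  rw [e, e, e, fisher_family hM, gamma_eq]
  simp only [trace_cInner]
  simp

lemma conj_vecMulVec {m n : Type*} [Fintype m] (K : Matrix n m ℂ) (u v : m → ℂ) :
    K * Matrix.vecMulVec u (star v) * Kᴴ = Matrix.vecMulVec (K *ᵥ u) (star (K *ᵥ v)) := by
  rw [Matrix.mul_vecMulVec, Matrix.vecMulVec_mul, Matrix.star_mulVec]

lemma fisher_channel {m n : Type*} [Fintype m] [Fintype n] [DecidableEq m] [DecidableEq n] {r : ℕ}
    {M : Fin r → Matrix n n ℂ} (hM : IsPOVM M) (x y : m → ℂ) (h : (cInner x y).re = 0)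
    {E : Matrix m m ℂ → Matrix n n ℂ} (hE : IsQuantumChannel E) :
    FisherInfo (E (Matrix.vecMulVec x (star x)))
      (E (Matrix.vecMulVec y (star x) + Matrix.vecMulVec x (star y))) M
      ≤ 4 * (gammaPOVM M * (cInner y y).re) := by
  obtain ⟨κ, K, hK, hE⟩ := hE
  let T : (m → ℂ) → Matrix n (Fin κ) ℂ := fun u => Matrix.of fun k j => (K j *ᵥ u) k
  have e : ∀ u v : m → ℂ, ∑ j, K j * Matrix.vecMulVec u (star v) * (K j)ᴴ = T u * (T v)ᴴ := by
    intro u v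
    ext k l
    rw [Matrix.sum_apply, Matrix.mul_apply]
    refine Finset.sum_congr rfl fun j _ => ?_
    rw [conj_vecMulVec]
    simp [T, Matrix.vecMulVec]
  have ht : ∀ u v : m → ℂ, ((T u)ᴴ * T v).trace = cInner u v := by
    intro u v
    have : cInner u v = cInner u ((∑ j, (K j)ᴴ * K j) *ᵥ v) := by rw [hK, Matrix.one_mulVec]
    rw [this, Matrix.sum_mulVec, cInner_eq, dotProduct_sum, Matrix.trace]
    refine Finset.sum_congr rfl fun j _ => ?_
    rw [← Matrix.mulVec_mulVec, Matrix.dotProduct_mulVec, ← Matrix.star_mulVec]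
    simp [T, Matrix.mul_apply, dotProduct]
  rw [hE, hE]
  simp only [Matrix.mul_add, Matrix.add_mul, Finset.sum_add_distrib, e]
  rw [fisher_family hM]
  refine mul_le_mul_of_nonneg_left ?_ (by norm_num)
  rw [← ht y y]
  exact family_bound hM _ _ (by rw [ht, h])

lemma exists_unitary_cols {d : ℕ} (i0 i1 : Fin d) (hne : i0 ≠ i1) (u v : Fin d → ℂ)
    (hu : cInner u u = 1) (hv : cInner v v = 1) (huv : cInner u v = 0) :
    ∃ P : Matrix (Fin d) (Fin d) ℂ, Pᴴ * P = 1 ∧ P *ᵥ (Pi.single i0 1) = u ∧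
      P *ᵥ (Pi.single i1 1) = v := by
  have hin : ∀ x y : Fin d → ℂ, inner ℂ (WithLp.toLp 2 x) (WithLp.toLp 2 y) = cInner x y := by
    intro x y
    simp [PiLp.inner_apply, cInner, mul_comm]
  have hvu : cInner v u = 0 := by rw [← cInner_conj, huv]; simp
  let w : Fin d → EuclideanSpace ℂ (Fin d) := fun i =>
    if i = i0 then WithLp.toLp 2 u else WithLp.toLp 2 v
  have hw : Orthonormal ℂ (({i0, i1} : Set (Fin d)).domRestrict w) := by
    rw [orthonormal_iff_ite]
    rintro ⟨i, hi⟩ ⟨j, hj⟩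
    have hi' : i = i0 ∨ i = i1 := hi
    have hj' : j = i0 ∨ j = i1 := hj
    change inner ℂ (w i) (w j) = _
    simp only [Subtype.mk.injEq]
    have w0 : w i0 = WithLp.toLp 2 u := if_pos rfl
    have w1 : w i1 = WithLp.toLp 2 v := if_neg hne.symm
    rcases hi' with rfl | rfl <;> rcases hj' with rfl | rfl <;>
      simp only [w0, w1, hin, hu, hv, huv, hvu, hne, hne.symm, if_true, if_false]
  obtain ⟨b, hb⟩ := hw.exists_orthonormalBasis_extension_of_card_eq (by simp)
  refine ⟨Matrix.of fun k j => b j k, ?_, ?_, ?_⟩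
  · ext j k
    have := (orthonormal_iff_ite.1 b.orthonormal) j k
    rw [Matrix.mul_apply, Matrix.one_apply, ← this]
    simp [PiLp.inner_apply, mul_comm]
  · ext k
    simp [hb i0 (by simp), w]
  · ext k
    simp [hb i1 (by simp), w, hne.symm]

lemma exists_unitary {d : ℕ} (u v u' v' : Fin d → ℂ)
    (hu : cInner u u = 1) (hv : cInner v v = 1) (huv : cInner u v = 0)
    (hu' : cInner u' u' = 1) (hv' : cInner v' v' = 1) (huv' : cInner u' v' = 0) :
    ∃ U ∈ Matrix.unitaryGroup (Fin d) ℂ, U *ᵥ u = u' ∧ U *ᵥ v = v' := by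
  have hd : 2 ≤ d := by
    by_contra hlt
    have : d = 0 ∨ d = 1 := by omega
    rcases this with rfl | rfl
    · simp [cInner] at hu
    · simp only [cInner, Finset.univ_unique, Finset.sum_singleton, mul_eq_zero] at hu hv huv
      rcases huv with h | h
      · rw [h] at hu; simp at hu
      · rw [h] at hv; simp at hv
  have hne : (⟨0, by omega⟩ : Fin d) ≠ ⟨1, by omega⟩ := by simp
  obtain ⟨P, hP, hP1, hP2⟩ := exists_unitary_cols _ _ hne u v hu hv huv
  obtain ⟨Q, hQ, hQ1, hQ2⟩ := exists_unitary_cols _ _ hne u' v' hu' hv' huv'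
  refine ⟨Q * Pᴴ, ?_, ?_, ?_⟩
  · rw [Matrix.mem_unitaryGroup_iff', Matrix.star_eq_conjTranspose, Matrix.conjTranspose_mul,
      Matrix.conjTranspose_conjTranspose, Matrix.mul_assoc, ← Matrix.mul_assoc Qᴴ, hQ,
      Matrix.one_mul]
    exact mul_eq_one_comm.1 hP
  · rw [← hP1, ← Matrix.mulVec_mulVec, Matrix.mulVec_mulVec _ Pᴴ, hP, Matrix.one_mulVec, hQ1]
  · rw [← hP2, ← Matrix.mulVec_mulVec, Matrix.mulVec_mulVec _ Pᴴ, hP, Matrix.one_mulVec, hQ2]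

lemma gamma_tensor {n : Type*} [Fintype n] {a r : ℕ} (M : Fin r → Matrix n n ℂ)
    (φ χ : n × Fin a → ℂ) :
    gammaSummand (fun i => (M i) ⊗ₖ (1 : Matrix (Fin a) (Fin a) ℂ)) φ χ
      = ∑ i, ((Matrix.of fun k j => φ (k, j))ᴴ * M i * (Matrix.of fun k j => χ (k, j))).trace.re ^ 2
        / ((Matrix.of fun k j => φ (k, j))ᴴ * M i * (Matrix.of fun k j => φ (k, j))).trace.re := by
  have e : ∀ (N : Matrix n n ℂ) (x y : n × Fin a → ℂ),
      cInner x ((N ⊗ₖ (1 : Matrix (Fin a) (Fin a) ℂ)) *ᵥ y)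
        = ((Matrix.of fun k j => x (k, j))ᴴ * N * (Matrix.of fun k j => y (k, j))).trace := by
    intro N x y
    rw [trace_cInner]
    simp only [cInner, Fintype.sum_prod_type]
    rw [Finset.sum_comm]
    refine Finset.sum_congr rfl fun j _ => Finset.sum_congr rfl fun k _ => ?_
    simp [Matrix.mulVec, dotProduct, Fintype.sum_prod_type, Matrix.one_apply]
  rw [gamma_eq]
  simp only [e]

lemma cInner_prod {n : Type*} [Fintype n] {a : ℕ} (x y : n × Fin a → ℂ) :
    ((Matrix.of fun k j => x (k, j))ᴴ * (Matrix.of fun k j => y (k, j))).trace = cInner x y := by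
  simp only [cInner, Fintype.sum_prod_type]
  rw [Finset.sum_comm]
  simp [Matrix.trace, Matrix.mul_apply]

lemma gamma_tensor_eq {n : Type*} [Fintype n] [DecidableEq n] {r : ℕ} {M : Fin r → Matrix n n ℂ}
    (hM : IsPOVM M) {a : ℕ} (ha : 1 ≤ a) :
    gammaPOVM (fun i => (M i) ⊗ₖ (1 : Matrix (Fin a) (Fin a) ℂ)) = gammaPOVM M := by
  have hub : ∀ φ χ : n × Fin a → ℂ, cInner χ χ = 1 → cInner φ χ = 0 →
      gammaSummand (fun i => (M i) ⊗ₖ (1 : Matrix (Fin a) (Fin a) ℂ)) φ χ ≤ gammaPOVM M := by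
    intro φ χ h2 h3
    rw [gamma_tensor]
    refine (family_bound hM _ _ ?_).trans ?_
    · rw [cInner_prod, h3]; simp
    · rw [cInner_prod, h2]; simp
  apply le_antisymm
  · refine Real.sSup_le ?_ (gammaPOVM_nonneg hM)
    rintro _ ⟨φ, χ, -, h2, h3, rfl⟩
    exact hub φ χ h2 h3
  · have hnn : 0 ≤ gammaPOVM (fun i => (M i) ⊗ₖ (1 : Matrix (Fin a) (Fin a) ℂ)) := by
      apply Real.sSup_nonneg
      rintro _ ⟨φ, χ, -, h2, h3, rfl⟩
      rw [gamma_tensor]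
      refine Finset.sum_nonneg fun i _ => div_nonneg (sq_nonneg _) ?_
      rw [trace_cInner, Complex.re_sum]
      exact Finset.sum_nonneg fun j _ => cInner_psd (hM.1 i) _
    refine Real.sSup_le ?_ hnn
    rintro _ ⟨x, y, h1, h2, h3, rfl⟩
    let j0 : Fin a := ⟨0, ha⟩
    let L : (n → ℂ) → n × Fin a → ℂ := fun x p => if p.2 = j0 then x p.1 else 0
    have hL : ∀ x y, cInner (L x) (L y) = cInner x y := by
      intro x y
      simp only [cInner, Fintype.sum_prod_type, L]
      refine Finset.sum_congr rfl fun k _ => ?_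
      rw [Finset.sum_eq_single j0] <;> simp +contextual
    have hz : ∀ (x y : n → ℂ) (N : Matrix n n ℂ),
        ((Matrix.of fun k j => L x (k, j))ᴴ * N * (Matrix.of fun k j => L y (k, j))).trace
          = cInner x (N *ᵥ y) := by
      intro x y N
      rw [trace_cInner, Finset.sum_eq_single j0]
      · simp [L]
      · intro j _ hj
        simp [L, hj, cInner]
      · simp
    apply le_csSup
    · refine ⟨gammaPOVM M, ?_⟩
      rintro _ ⟨φ, χ, -, h2, h3, rfl⟩
      exact hub φ χ h2 h3
    · refine ⟨L x, L y, by rw [hL, h1], by rw [hL, h2], by rw [hL, h3], ?_⟩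
      rw [gamma_tensor, gamma_eq]
      simp only [hz]

lemma unitary_sup {d r : ℕ} {M : Fin r → Matrix (Fin d) (Fin d) ℂ} (hM : IsPOVM M)
    (x z : Fin d → ℂ) (hx : cInner x x = 1) (hxz : cInner x z = 0) {B : ℝ} (hB0 : 0 ≤ B)
    (hB : ∀ U ∈ Matrix.unitaryGroup (Fin d) ℂ, 4 * gammaSummand M (U *ᵥ x) (U *ᵥ z) ≤ B) :
    4 * (gammaPOVM M * (cInner z z).re) ≤ B := by
  by_cases hz0 : z = 0
  · simpa [hz0, cInner] using hB0
  have hzp := cInner_self_pos hz0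
  set N := (cInner z z).re with hN
  have : gammaPOVM M ≤ B / (4 * N) := by
    refine Real.sSup_le ?_ (by positivity)
    rintro _ ⟨φ, χ, h1, h2, h3, rfl⟩
    set t := (√N)⁻¹ with ht
    have e : ∀ (s : ℝ) (x : Fin d → ℂ), s • x = (s : ℂ) • x := fun s x => by ext; simp
    have hu := cInner_unit hz0
    rw [← hN, ← ht, e] at hu
    obtain ⟨U, hU, hU1, hU2⟩ := exists_unitary x ((t : ℂ) • z) φ χ hx hu
      (by rw [cInner_smul_right, hxz, mul_zero]) h1 h2 h3
    have hb := hB U hU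
    have ht0 : t ≠ 0 := inv_ne_zero (Real.sqrt_pos.2 hzp).ne'
    have ht2 : t ^ 2 = N⁻¹ := by rw [ht, inv_pow, Real.sq_sqrt hzp.le]
    have hsc := gamma_smul M (U *ᵥ x) (U *ᵥ z) one_ne_zero t
    rw [Complex.ofReal_one, one_smul, ← Matrix.mulVec_smul, hU1, hU2, ht2] at hsc
    rw [hU1] at hb
    rw [hsc, le_div_iff₀ (by positivity)]
    field_simp
    linarith
  rw [le_div_iff₀ (by positivity)] at this
  linarith

lemma unitary_channel {n : Type*} [Fintype n] [DecidableEq n] {U : Matrix n n ℂ}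
    (hU : U ∈ Matrix.unitaryGroup n ℂ) : IsQuantumChannel (fun σ => U * σ * Uᴴ) :=
  ⟨1, fun _ => U, by
    rw [Fin.sum_univ_one]; exact Matrix.mem_unitaryGroup_iff'.1 hU, fun σ => by
    rw [Fin.sum_univ_one]⟩

lemma deriv_re {d : ℕ} (ψ : ℝ → Fin d → ℂ) (ψ' : Fin d → ℂ) (θ₀ : ℝ)
    (hnorm : ∀ θ, cInner (ψ θ) (ψ θ) = 1)
    (hder : ∀ k, HasDerivAt (fun θ => ψ θ k) (ψ' k) θ₀) : (cInner (ψ θ₀) ψ').re = 0 := by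
  have h : HasDerivAt (fun θ => cInner (ψ θ) (ψ θ))
      (∑ k, (star (ψ' k) * ψ θ₀ k + star (ψ θ₀ k) * ψ' k)) θ₀ := by
    unfold cInner
    exact HasDerivAt.fun_sum fun k _ => (hder k).star.mul (hder k)
  have h2 : (fun θ => cInner (ψ θ) (ψ θ)) = fun _ => 1 := funext hnorm
  rw [h2] at h
  have h3 := h.unique (hasDerivAt_const θ₀ (1 : ℂ))
  rw [Finset.sum_add_distrib] at h3
  change cInner ψ' (ψ θ₀) + cInner (ψ θ₀) ψ' = 0 at h3
  rw [← cInner_conj (ψ θ₀) ψ'] at h3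
  have := congrArg Complex.re h3
  simp only [Complex.add_re, RCLike.star_def, Complex.conj_re, Complex.zero_re] at this
  linarith

/-- for pure states, unitary preprocessing is optimal: `F^P = F^U`;
equivalently, the normalized QPFI is unchanged by tensoring the POVM with an identity on an
ancilla of any dimension. -/
theorem stmt5 {d r : ℕ} (hd : 1 ≤ d) (hr : 1 ≤ r)
    (ψ : ℝ → Fin d → ℂ) (ψ' : Fin d → ℂ) (θ₀ : ℝ)
    (hnorm : ∀ θ, cInner (ψ θ) (ψ θ) = 1)
    (hder : ∀ k, HasDerivAt (fun θ => ψ θ k) (ψ' k) θ₀)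
    (M : Fin r → Matrix (Fin d) (Fin d) ℂ) (hM : IsPOVM M) :
    QPFI (Matrix.vecMulVec (ψ θ₀) (star (ψ θ₀)))
        (Matrix.vecMulVec ψ' (star (ψ θ₀)) + Matrix.vecMulVec (ψ θ₀) (star ψ')) M
      = QUPFI (Matrix.vecMulVec (ψ θ₀) (star (ψ θ₀)))
        (Matrix.vecMulVec ψ' (star (ψ θ₀)) + Matrix.vecMulVec (ψ θ₀) (star ψ')) M
    ∧ ∀ a : ℕ, 1 ≤ a →
      gammaPOVM (fun i => (M i) ⊗ₖ (1 : Matrix (Fin a) (Fin a) ℂ)) = gammaPOVM M := by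
  refine ⟨?_, fun a ha => gamma_tensor_eq hM ha⟩
  set x := ψ θ₀ with hx
  have hx1 : cInner x x = 1 := hnorm θ₀
  have hre : (cInner x ψ').re = 0 := deriv_re ψ ψ' θ₀ hnorm hder
  set c := cInner x ψ' with hc
  set z := ψ' - c • x with hz
  have hxz : cInner x z = 0 := by
    rw [hz, cInner_sub_right, cInner_smul_right, hx1, ← hc]; ring
  have hρ : Matrix.vecMulVec ψ' (star x) + Matrix.vecMulVec x (star ψ')
      = Matrix.vecMulVec z (star x) + Matrix.vecMulVec x (star z) := by
    have hcc : star c = -c := by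
      apply Complex.ext <;> simp [hre]
    have hψ : ψ' = z + c • x := by simp [hz]
    rw [hψ]
    ext i j
    have hcc' : (starRingEnd ℂ) c = -c := hcc
    simp only [Matrix.add_apply, Matrix.vecMulVec_apply, Pi.star_apply, Pi.add_apply, Pi.smul_apply,
      smul_eq_mul, star_add, star_mul', hcc]
    ring
  rw [hρ]
  have hF : ∀ U : Matrix (Fin d) (Fin d) ℂ,
      FisherInfo (U * Matrix.vecMulVec x (star x) * Uᴴ)
        (U * (Matrix.vecMulVec z (star x) + Matrix.vecMulVec x (star z)) * Uᴴ) M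
        = 4 * gammaSummand M (U *ᵥ x) (U *ᵥ z) := by
    intro U
    rw [Matrix.mul_add, Matrix.add_mul, conj_vecMulVec, conj_vecMulVec, conj_vecMulVec,
      fisher_pure hM]
  have hch : ∀ E : Matrix (Fin d) (Fin d) ℂ → Matrix (Fin d) (Fin d) ℂ, IsQuantumChannel E →
      FisherInfo (E (Matrix.vecMulVec x (star x)))
        (E (Matrix.vecMulVec z (star x) + Matrix.vecMulVec x (star z))) M
        ≤ 4 * (gammaPOVM M * (cInner z z).re) := fun E hE =>
    fisher_channel hM x z (by rw [hxz]; rfl) hE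
  have hUch : ∀ U ∈ Matrix.unitaryGroup (Fin d) ℂ, 4 * gammaSummand M (U *ᵥ x) (U *ᵥ z)
      ≤ 4 * (gammaPOVM M * (cInner z z).re) := fun U hU => by
    rw [← hF U]
    exact hch (fun σ => U * σ * Uᴴ) (unitary_channel hU)
  have hnn : 0 ≤ 4 * (gammaPOVM M * (cInner z z).re) :=
    mul_nonneg (by norm_num) (mul_nonneg (gammaPOVM_nonneg hM) (cInner_self_nonneg z))
  have hnonneg : 0 ≤ QUPFI (Matrix.vecMulVec x (star x))
      (Matrix.vecMulVec z (star x) + Matrix.vecMulVec x (star z)) M := by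
    apply Real.sSup_nonneg
    rintro _ ⟨U, hU, rfl⟩
    rw [hF]
    exact mul_nonneg (by norm_num) (gamma_nonneg hM _ _)
  apply le_antisymm
  · refine Real.sSup_le ?_ hnonneg
    rintro _ ⟨E, hE, rfl⟩
    refine (hch E hE).trans (unitary_sup hM x z hx1 hxz hnonneg fun U hU => ?_)
    refine le_csSup ⟨4 * (gammaPOVM M * (cInner z z).re), ?_⟩ ⟨U, hU, (hF U).symm⟩
    rintro _ ⟨V, hV, rfl⟩
    rw [hF]
    exact hUch V hV
  · refine csSup_le_csSup ⟨4 * (gammaPOVM M * (cInner z z).re), ?_⟩ ⟨_, 1, one_mem _, rfl⟩ ?_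
    · rintro _ ⟨E, hE, rfl⟩
      exact hch E hE
    · rintro _ ⟨U, hU, rfl⟩
      exact ⟨fun σ => U * σ * Uᴴ, unitary_channel hU, rfl⟩
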